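/- arXiv:2105.08513 — 2 statements merged into one kernel-verified Lean document; each statement's English description precedes it below -/
import Mathlib

section
/- Each Gårding cone Γₖ = {λ ∈ ℝⁿ : σⱼ(λ) > 0 for 1 ≤ j ≤ k} is a convex cone: it is closed under addition and under multiplication by positive scalars. -/
/-- The `j`-th elementary symmetric polynomial of `λ₁,…,λₙ`. -/
def esymm (n j : ℕ) (lam : Fin n → ℝ) : ℝ :=
  ∑ s ∈ Finset.univ.powersetCard j, ∏ i ∈ s, lam i

/-- The Gårding cone `Γₖ = {λ : σⱼ(λ) > 0 for all 1 ≤ j ≤ k}`. -/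
def GardingCone (n k : ℕ) : Set (Fin n → ℝ) :=
  {lam | ∀ j, 1 ≤ j → j ≤ k → 0 < esymm n j lam}

open Polynomial in
theorem splits_derivative_real {p : ℝ[X]} (hp : p.Splits) : (derivative p).Splits := by
  rw [splits_iff_card_roots] at *
  have h1 := card_roots_le_derivative p
  have h2 := (derivative p).card_roots'
  have h3 := natDegree_derivative_le p
  by_cases h0 : p.natDegree = 0
  · omega
  · omega

open Polynomial in
theorem splits_iter_derivative_real {p : ℝ[X]} (hp : p.Splits) (k : ℕ) :
    (derivative^[k] p).Splits := by
  induction k with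
  | zero => simpa using hp
  | succ k ih =>
    rw [Function.iterate_succ_apply']
    exact splits_derivative_real ih

open Polynomial in
theorem laguerre_real {p : ℝ[X]} (hp : p.Splits) (t : ℝ) :
    0 ≤ (derivative p).eval t ^ 2 - p.eval t * (derivative (derivative p)).eval t := by
  obtain ⟨m, hm⟩ := splits_iff_exists_multiset.1 hp
  have key : ∀ (m : Multiset ℝ) (c : ℝ) (q : ℝ[X]),
      q = C c * (m.map (fun a => X - C a)).prod →
      0 ≤ (derivative q).eval t ^ 2 - q.eval t * (derivative (derivative q)).eval t := by
    intro m c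
    induction m using Multiset.induction with
    | empty => intro q hq; simp [hq]
    | cons a m ih =>
      intro q hq
      have hq' : q = (X - C a) * (C c * (m.map (fun a => X - C a)).prod) := by
        rw [hq, Multiset.map_cons, Multiset.prod_cons]; ring
      have := ih _ rfl
      generalize (C c * (m.map (fun a => X - C a)).prod) = r at *
      subst hq'
      simp only [derivative_mul, derivative_sub, derivative_X, derivative_C, derivative_add,
        eval_add, eval_mul, eval_sub, eval_X, eval_C, sub_zero, one_mul]
      nlinarith [mul_nonneg (sq_nonneg (t - a)) this, sq_nonneg (r.eval t)]
  exact key m _ p hm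

/-- elementary symmetric sums over a finset -/
def gE {ι : Type*} (s : Finset ι) (j : ℕ) (x : ι → ℝ) : ℝ :=
  ∑ t ∈ s.powersetCard j, ∏ i ∈ t, x i

theorem gE_zero {ι : Type*} (s : Finset ι) (x : ι → ℝ) : gE s 0 x = 1 := by
  simp [gE]

theorem gE_empty {ι : Type*} (j : ℕ) (x : ι → ℝ) : gE (∅ : Finset ι) (j+1) x = 0 := by
  unfold gE
  rw [Finset.powersetCard_eq_empty.2 (by simp), Finset.sum_empty]

theorem gE_insert {ι : Type*} [DecidableEq ι] {s : Finset ι} {a : ι} (ha : a ∉ s) (j : ℕ)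
    (x : ι → ℝ) : gE (insert a s) (j+1) x = x a * gE s j x + gE s (j+1) x := by
  unfold gE
  rw [Finset.powersetCard_succ_insert ha, Finset.sum_union, Finset.sum_image, Finset.mul_sum,
    add_comm]
  · congr 1
    apply Finset.sum_congr rfl
    intro t ht
    rw [Finset.prod_insert]
    intro h
    exact ha ((Finset.mem_powersetCard.1 ht).1 h)
  · intro t ht u hu h
    have h1 : a ∉ t := fun h => ha ((Finset.mem_powersetCard.1 ht).1 h)
    have h2 : a ∉ u := fun h => ha ((Finset.mem_powersetCard.1 hu).1 h)
    rw [← Finset.erase_insert h1, ← Finset.erase_insert h2]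
    exact congrArg (fun z => Finset.erase z a) h
  · rw [Finset.disjoint_left]
    intro t ht ht'
    obtain ⟨u, hu, rfl⟩ := Finset.mem_image.1 ht'
    exact ha ((Finset.mem_powersetCard.1 ht).1 (Finset.mem_insert_self _ _))

theorem gE_erase {ι : Type*} [DecidableEq ι] {s : Finset ι} {a : ι} (ha : a ∈ s) (j : ℕ)
    (x : ι → ℝ) : gE s (j+1) x = x a * gE (s.erase a) j x + gE (s.erase a) (j+1) x := by
  have := gE_insert (Finset.notMem_erase a s) j x
  rwa [Finset.insert_erase ha] at this

theorem gE_euler {ι : Type*} [DecidableEq ι] (s : Finset ι) (x : ι → ℝ) (k : ℕ) :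
    ∑ i ∈ s, x i * gE (s.erase i) k x = (k + 1) * gE s (k+1) x := by
  induction s using Finset.induction_on generalizing k with
  | empty => simp [gE_empty]
  | insert a s ha ih =>
    rw [Finset.sum_insert ha, Finset.erase_insert ha, gE_insert ha]
    have h : ∀ i ∈ s, (insert a s).erase i = insert a (s.erase i) := by
      intro i hi
      rw [Finset.erase_insert_of_ne]
      rintro rfl
      exact ha hi
    have hn : ∀ i, a ∉ s.erase i := fun i h => ha (Finset.mem_of_mem_erase h)
    cases k with
    | zero =>
      have := ih 0
      simp only [gE_zero] at *
      rw [this]; push_cast; ring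
    | succ k =>
      have : ∑ i ∈ s, x i * gE ((insert a s).erase i) (k+1) x
          = x a * ∑ i ∈ s, x i * gE (s.erase i) k x + ∑ i ∈ s, x i * gE (s.erase i) (k+1) x := by
        rw [Finset.mul_sum, ← Finset.sum_add_distrib]
        apply Finset.sum_congr rfl
        intro i hi
        rw [h i hi, gE_insert (hn i)]
        ring
      rw [this, ih, ih]
      push_cast; ring

open Polynomial in
theorem gE_coeff {ι : Type*} [DecidableEq ι] (s : Finset ι) (x : ι → ℝ) (k : ℕ) :
    (∏ i ∈ s, (C (x i) * X + 1)).coeff k = gE s k x := by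
  induction s using Finset.induction_on generalizing k with
  | empty => cases k <;> simp [gE_empty, gE_zero, coeff_one]
  | insert a s ha ih =>
    rw [Finset.prod_insert ha]
    cases k with
    | zero =>
      have := ih 0
      rw [gE_zero] at *
      simp [add_mul, mul_assoc, this]
    | succ k =>
      rw [gE_insert ha, add_mul, mul_assoc, coeff_add, coeff_C_mul, coeff_X_mul, one_mul, ih, ih]

open Polynomial in
theorem gE_newton {ι : Type*} [DecidableEq ι] (s : Finset ι) (x : ι → ℝ) (k : ℕ) :
    gE s k x * gE s (k+2) x ≤ gE s (k+1) x ^ 2 := by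
  set p : ℝ[X] := ∏ i ∈ s, (C (x i) * X + 1) with hp
  have hs : p.Splits := by
    apply Splits.prod
    intro i _
    apply Splits.of_natDegree_le_one
    exact natDegree_linear_le (b := 1)
  have hl := laguerre_real (splits_iter_derivative_real hs k) 0
  rw [← Function.iterate_succ_apply' derivative, ← Function.iterate_succ_apply' derivative] at hl
  simp only [← coeff_zero_eq_eval_zero, coeff_iterate_derivative, zero_add, hp, gE_coeff,
    Nat.descFactorial_self, nsmul_eq_mul, Nat.factorial_succ] at hl
  push_cast at hl
  have hf : (0:ℝ) < (k.factorial : ℝ) := by positivity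
  have hk : (0:ℝ) ≤ k := by positivity
  have h2 : 0 ≤ ((k.factorial : ℝ)^2 * (k+1)) *
      ((k+1) * gE s (k+1) x ^ 2 - (k+2) * (gE s k x * gE s (k+2) x)) := by
    linarith
  have h3 := nonneg_of_mul_nonneg_right h2 (by positivity)
  by_contra hc
  push Not at hc
  nlinarith [sq_nonneg (gE s (k+1) x)]

/-- the cone -/
def gPos {ι : Type*} (s : Finset ι) (k : ℕ) (x : ι → ℝ) : Prop := ∀ j, j ≤ k → 0 < gE s j x

theorem gPos_erase {ι : Type*} [DecidableEq ι] {s : Finset ι} {a : ι} (ha : a ∈ s) (k : ℕ)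
    (x : ι → ℝ) (h : gPos s (k+1) x) : gPos (s.erase a) k x := by
  induction k with
  | zero =>
    intro j hj
    obtain rfl : j = 0 := by omega
    rw [gE_zero]; norm_num
  | succ k ih =>
    have ih' := ih (fun j hj => h j (by omega))
    intro j hj
    rcases Nat.lt_or_ge j (k+1) with hlt | hge
    · exact ih' j (by omega)
    obtain rfl : j = k + 1 := by omega
    have h0 := ih' k le_rfl
    have h1 := h (k+1) (by omega)
    have h2 := h (k+1+1) (by omega)
    rw [gE_erase ha] at h1 h2
    have hN := gE_newton (s.erase a) x k
    by_contra hc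
    push Not at hc
    have e : k + 1 + 1 = k + 2 := rfl
    rw [e] at h2
    generalize gE (s.erase a) k x = A at *
    generalize gE (s.erase a) (k+1) x = B at *
    generalize gE (s.erase a) (k+2) x = D at *
    nlinarith [mul_pos h0 h2, mul_nonneg (neg_nonneg.2 hc) h1.le]

theorem sq_div_subadd {a b u v w : ℝ} (hu : 0 < u) (hv : 0 < v) (hw : u + v ≤ w) :
    (a + b)^2 / w ≤ a^2 / u + b^2 / v := by
  have h1 : (a+b)^2 / w ≤ (a+b)^2/(u+v) := by gcongr
  refine h1.trans ?_
  rw [div_add_div _ _ hu.ne' hv.ne', div_le_div_iff₀ (by positivity) (by positivity)]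
  nlinarith [sq_nonneg (a * v - b * u)]

theorem gE_quot {ι : Type*} [DecidableEq ι] (s : Finset ι) (k : ℕ) (x : ι → ℝ)
    (h : gPos s (k+1) x) :
    (k + 2) * (gE s (k+2) x / gE s (k+1) x) =
      ∑ i ∈ s, (x i - x i ^ 2 / (x i + gE (s.erase i) (k+1) x / gE (s.erase i) k x)) := by
  have := gE_euler s x (k+1)
  push_cast at this
  have e : (k:ℝ) + 1 + 1 = k + 2 := by ring
  rw [e] at this
  rw [← mul_div_assoc, ← this, Finset.sum_div]
  apply Finset.sum_congr rfl
  intro i hi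
  have h1 := h (k+1) le_rfl
  have h0 := gPos_erase hi k x h k le_rfl
  have he := gE_erase hi k x
  have hu : x i + gE (s.erase i) (k+1) x / gE (s.erase i) k x
      = gE s (k+1) x / gE (s.erase i) k x := by
    rw [he]; field_simp
  have hd : gE (s.erase i) (k+1) x = gE s (k+1) x - x i * gE (s.erase i) k x := by linarith
  rw [hu, hd]
  field_simp

theorem gmain {ι : Type*} [DecidableEq ι] (k : ℕ) : ∀ (s : Finset ι) (x y : ι → ℝ),
    gPos s k x → gPos s k y → gPos s k (x + y) ∧
      gE s (k+1) x / gE s k x + gE s (k+1) y / gE s k y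
        ≤ gE s (k+1) (x + y) / gE s k (x + y) := by
  induction k with
  | zero =>
    intro s x y hx hy
    refine ⟨?_, ?_⟩
    · intro j hj
      obtain rfl : j = 0 := by omega
      rw [gE_zero]; norm_num
    · have hone : ∀ z : ι → ℝ, gE s (0+1) z = ∑ i ∈ s, z i := by
        intro z
        have := gE_euler s z 0
        simp only [gE_zero] at this
        push_cast at this
        linarith [Finset.sum_congr (rfl : s = s) (fun i _ => mul_one (z i))]
      simp only [hone, gE_zero, div_one, Pi.add_apply, Finset.sum_add_distrib]
      exact le_rfl
  | succ k ih =>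
    intro s x y hx hy
    have hx' : gPos s k x := fun j hj => hx j (by omega)
    have hy' : gPos s k y := fun j hj => hy j (by omega)
    obtain ⟨hp, hq⟩ := ih s x y hx' hy'
    have hxy : gPos s (k+1) (x+y) := by
      intro j hj
      rcases Nat.lt_or_ge j (k+1) with hlt | hge
      · exact hp j (by omega)
      obtain rfl : j = k + 1 := by omega
      have h1 := div_pos (hx (k+1) le_rfl) (hx k (by omega))
      have h2 := div_pos (hy (k+1) le_rfl) (hy k (by omega))
      have h3 := hp k le_rfl
      exact (div_pos_iff_of_pos_right h3).1 (by linarith)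
    refine ⟨hxy, ?_⟩
    have hk : (0:ℝ) < k + 2 := by positivity
    refine le_of_mul_le_mul_left ?_ hk
    have e : k + 1 + 1 = k + 2 := rfl
    rw [e, mul_add, gE_quot s k x hx, gE_quot s k y hy, gE_quot s k _ hxy,
      ← Finset.sum_add_distrib]
    apply Finset.sum_le_sum
    intro i hi
    have hu : ∀ z : ι → ℝ, gPos s (k+1) z →
        0 < z i + gE (s.erase i) (k+1) z / gE (s.erase i) k z := by
      intro z hz
      have h1 := hz (k+1) le_rfl
      have h0 := gPos_erase hi k z hz k le_rfl
      rw [gE_erase hi] at h1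
      have : z i + gE (s.erase i) (k+1) z / gE (s.erase i) k z =
        (z i * gE (s.erase i) k z + gE (s.erase i) (k+1) z) / gE (s.erase i) k z := by
        field_simp
      rw [this]
      positivity
    have hs := (ih (s.erase i) x y (gPos_erase hi k x hx) (gPos_erase hi k y hy)).2
    have := sq_div_subadd (a := x i) (b := y i)
      (w := (x + y) i + gE (s.erase i) (k+1) (x+y) / gE (s.erase i) k (x+y))
      (hu x hx) (hu y hy) (by rw [Pi.add_apply]; linarith)
    rw [Pi.add_apply] at *
    linarith

theorem gPos_iff (n k : ℕ) (x : Fin n → ℝ) : x ∈ GardingCone n k ↔ gPos Finset.univ k x := by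
  constructor
  · intro h j hj
    rcases Nat.eq_zero_or_pos j with rfl | h0
    · rw [gE_zero]; norm_num
    · exact h j h0 hj
  · intro h j _ hj
    exact h j hj

/-- each Gårding cone `Γₖ` is a convex cone: it is closed under
addition and under multiplication by positive scalars. -/
theorem garding_cone_is_convex_cone (n k : ℕ) :
    (∀ lam mu, lam ∈ GardingCone n k → mu ∈ GardingCone n k →
      lam + mu ∈ GardingCone n k) ∧
    (∀ (t : ℝ) (lam), 0 < t → lam ∈ GardingCone n k → t • lam ∈ GardingCone n k) := by
  refine ⟨?_, ?_⟩
  · intro x y hx hy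
    rw [gPos_iff] at *
    exact (gmain k _ x y hx hy).1
  · intro t x ht hx j h1 hj
    have h := hx j h1 hj
    have : esymm n j (t • x) = t ^ j * esymm n j x := by
      unfold esymm
      rw [Finset.mul_sum]
      apply Finset.sum_congr rfl
      intro s hs
      simp only [Pi.smul_apply, smul_eq_mul, Finset.prod_mul_distrib, Finset.prod_const,
        (Finset.mem_powersetCard.1 hs).2]
    rw [this]
    positivity
end

section
/- (Maximum principle for domains of small volume) Let Ω ⊂ ℝⁿ be bounded open with diameter d, c : Ω → ℝ bounded (no sign assumption), and u ∈ C²(Ω) ∩ C(closure Ω) with Δu + c(x)u ≥ 0 in Ω and u ≤ 0 on ∂Ω. There exists δ > 0 depending only on n, d, and sup c⁺ such that if the Lebesgue measure |Ω| ≤ δ, then u ≤ 0 in Ω. -/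
open MeasureTheory

noncomputable def laplacian {n : ℕ} (u : EuclideanSpace ℝ (Fin n) → ℝ)
    (x : EuclideanSpace ℝ (Fin n)) : ℝ :=
  ∑ i, fderiv ℝ (fun y => fderiv ℝ u y (EuclideanSpace.single i 1)) x
    (EuclideanSpace.single i 1)

open Filter Topology in
/-- One-dimensional necessary second order condition. -/
lemma second_deriv_nonpos_aux {g : ℝ → ℝ} (hc : ContinuousAt g 0)
    (hmax : IsLocalMax g 0) : deriv (deriv g) 0 ≤ 0 := by
  by_contra! h
  have hmin := isLocalMin_of_deriv_deriv_pos h hmax.deriv_eq_zero hc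
  have hconst : g =ᶠ[𝓝 0] fun _ => g 0 := by
    filter_upwards [hmax, hmin] with t h1 h2
    exact le_antisymm h1 h2
  have h1 : deriv g =ᶠ[𝓝 0] fun _ => 0 := by
    have := hconst.deriv
    simpa using this
  rw [h1.deriv_eq] at h
  simp at h

open Filter Topology in
lemma local_max_conditions {n : ℕ} {u : EuclideanSpace ℝ (Fin n) → ℝ}
    {y p : EuclideanSpace ℝ (Fin n)} (hu : ContDiffAt ℝ 2 u y)
    (hmax : IsLocalMax (fun x => u x - inner ℝ p x) y) :
    fderiv ℝ u y = InnerProductSpace.toDual ℝ _ p ∧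
      ∀ v, fderiv ℝ (fderiv ℝ u) y v v ≤ 0 := by
  have hd : DifferentiableAt ℝ u y := hu.differentiableAt (by norm_num)
  have hev : ∀ᶠ x in 𝓝 y, DifferentiableAt ℝ u x := by
    have := hu.eventually (by simp)
    filter_upwards [this] with x hx
    exact hx.differentiableAt (by norm_num)
  have hfd : DifferentiableAt ℝ (fderiv ℝ u) y :=
    (hu.fderiv_right (m := 1) (by norm_num)).differentiableAt (by norm_num)
  constructor
  · have h1 : HasFDerivAt (fun x => u x - inner ℝ p x)
        (fderiv ℝ u y - InnerProductSpace.toDual ℝ _ p) y :=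
      hd.hasFDerivAt.sub ((InnerProductSpace.toDual ℝ _ p).hasFDerivAt)
    exact sub_eq_zero.mp (hmax.hasFDerivAt_eq_zero h1)
  · intro v
    have hline : ∀ t : ℝ, HasDerivAt (fun t : ℝ => y + t • v) v t := by
      intro t
      simpa using ((hasDerivAt_id t).smul_const v).const_add y
    have htend : Tendsto (fun t : ℝ => y + t • v) (𝓝 0) (𝓝 y) := by
      have := (hline 0).continuousAt.tendsto
      simpa using this
    set g : ℝ → ℝ := fun t => u (y + t • v) - inner ℝ p (y + t • v) with hg
    have hgd : ∀ᶠ t in 𝓝 (0:ℝ), HasDerivAt g (fderiv ℝ u (y + t • v) v - inner ℝ p v) t := by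
      filter_upwards [htend.eventually hev] with t ht
      exact (ht.hasFDerivAt.comp_hasDerivAt t (hline t)).sub
        (((InnerProductSpace.toDual ℝ _ p).hasFDerivAt).comp_hasDerivAt t (hline t))
    have hgmax : IsLocalMax g 0 := by
      have := htend.eventually hmax
      unfold IsLocalMax IsMaxFilter
      filter_upwards [this] with t ht
      simpa [hg] using ht
    have h2 : deriv g =ᶠ[𝓝 0] fun t => fderiv ℝ u (y + t • v) v - inner ℝ p v :=
      hgd.mono fun t ht => ht.deriv
    have h3 : HasDerivAt (fun t : ℝ => fderiv ℝ u (y + t • v) v - inner ℝ p v)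
        (fderiv ℝ (fderiv ℝ u) y v v) 0 := by
      have hfd' : HasFDerivAt (fderiv ℝ u) (fderiv ℝ (fderiv ℝ u) y) (y + (0:ℝ) • v) := by
        simpa using hfd.hasFDerivAt
      have := hfd'.comp_hasDerivAt (0:ℝ) (hline 0)
      exact (this.clm_apply (hasDerivAt_const (0:ℝ) v) |>.sub_const (inner ℝ p v)).congr_deriv
        (by simp)
    have := second_deriv_nonpos_aux hgd.self_of_nhds.continuousAt hgmax
    rwa [h2.deriv_eq, h3.deriv] at this

lemma abs_det_le_of_nonpos {n : ℕ}
    (T : EuclideanSpace ℝ (Fin n) →ₗ[ℝ] EuclideanSpace ℝ (Fin n)) (hT : T.IsSymmetric)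
    (hneg : ∀ v, inner ℝ v (T v) ≤ 0) (B : ℝ) (hB : - LinearMap.trace ℝ _ T ≤ B) :
    |LinearMap.det T| ≤ B ^ n := by
  have hn : Module.finrank ℝ (EuclideanSpace ℝ (Fin n)) = n := by simp
  have hl : ∀ i, hT.eigenvalues hn i ≤ 0 := by
    intro i
    have := hneg (hT.eigenvectorBasis hn i)
    rw [hT.apply_eigenvectorBasis hn i, inner_smul_right, real_inner_self_eq_norm_sq] at this
    simpa using this
  have hle : ∀ i, |hT.eigenvalues hn i| ≤ B := by
    intro i
    refine le_trans ?_ hB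
    rw [hT.trace_eq_sum_eigenvalues hn, abs_of_nonpos (hl i)]
    simp only [RCLike.ofReal_real_eq_id, id]
    rw [← Finset.sum_neg_distrib]
    exact Finset.single_le_sum (f := fun i => - hT.eigenvalues hn i)
      (fun j _ => neg_nonneg.mpr (hl j)) (Finset.mem_univ i)
  rw [hT.det_eq_prod_eigenvalues hn]
  simp only [RCLike.ofReal_real_eq_id, id]
  rw [Finset.abs_prod]
  calc _ ≤ ∏ _i : Fin n, B := Finset.prod_le_prod (fun i _ => abs_nonneg _) (fun i _ => hle i)
    _ = B ^ n := by simp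

/-- The gradient map used in the ABP argument. -/
noncomputable def gradMap {n : ℕ} (u : EuclideanSpace ℝ (Fin n) → ℝ) :
    EuclideanSpace ℝ (Fin n) → EuclideanSpace ℝ (Fin n) :=
  fun x => (InnerProductSpace.toDual ℝ (EuclideanSpace ℝ (Fin n))).symm (fderiv ℝ u x)

lemma gradMap_inner {n : ℕ} {u : EuclideanSpace ℝ (Fin n) → ℝ}
    {y : EuclideanSpace ℝ (Fin n)} (hu : ContDiffAt ℝ 2 u y) :
    DifferentiableAt ℝ (gradMap u) y ∧
    ∀ v w, inner ℝ (fderiv ℝ (gradMap u) y v) w = fderiv ℝ (fderiv ℝ u) y v w := by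
  have hfd : DifferentiableAt ℝ (fderiv ℝ u) y :=
    (hu.fderiv_right (m := 1) (by norm_num)).differentiableAt (by norm_num)
  let L : StrongDual ℝ (EuclideanSpace ℝ (Fin n)) →L[ℝ] EuclideanSpace ℝ (Fin n) :=
    { toFun := fun l => (InnerProductSpace.toDual ℝ (EuclideanSpace ℝ (Fin n))).symm l
      map_add' := fun a b => map_add _ a b
      map_smul' := fun r a => by simp
      cont := (InnerProductSpace.toDual ℝ (EuclideanSpace ℝ (Fin n))).symm.continuous }
  have h : HasFDerivAt (gradMap u) (L.comp (fderiv ℝ (fderiv ℝ u) y)) y :=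
    L.hasFDerivAt.comp y hfd.hasFDerivAt
  refine ⟨h.differentiableAt, fun v w => ?_⟩
  rw [h.fderiv]
  exact InnerProductSpace.toDual_symm_apply

lemma laplacian_eq {n : ℕ} {u : EuclideanSpace ℝ (Fin n) → ℝ}
    {y : EuclideanSpace ℝ (Fin n)} (hu : ContDiffAt ℝ 2 u y) :
    LinearMap.trace ℝ _ (fderiv ℝ (gradMap u) y : EuclideanSpace ℝ (Fin n) →ₗ[ℝ] _)
      = laplacian u y := by
  have hfd : DifferentiableAt ℝ (fderiv ℝ u) y :=
    (hu.fderiv_right (m := 1) (by norm_num)).differentiableAt (by norm_num)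
  rw [LinearMap.trace_eq_sum_inner _ (EuclideanSpace.basisFun (Fin n) ℝ), laplacian]
  refine Finset.sum_congr rfl fun i _ => ?_
  rw [real_inner_comm]
  have h1 := (gradMap_inner hu).2 (EuclideanSpace.single i 1) (EuclideanSpace.single i 1)
  have h2 : fderiv ℝ (fun y => fderiv ℝ u y (EuclideanSpace.single i 1)) y
      (EuclideanSpace.single i 1) = fderiv ℝ (fderiv ℝ u) y (EuclideanSpace.single i 1)
      (EuclideanSpace.single i 1) := by
    rw [(hfd.hasFDerivAt.clm_apply (hasFDerivAt_const (EuclideanSpace.single i (1:ℝ)) y)).fderiv]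
    simp
  rw [h2, ← h1]
  simp

/-- The pointwise determinant bound at a contact point. -/
lemma contact_bound {n : ℕ} {u : EuclideanSpace ℝ (Fin n) → ℝ}
    {y p : EuclideanSpace ℝ (Fin n)} (hu : ContDiffAt ℝ 2 u y)
    (hmax : IsLocalMax (fun x => u x - inner ℝ p x) y) (B : ℝ) (hB : - laplacian u y ≤ B) :
    gradMap u y = p ∧ |(fderiv ℝ (gradMap u) y).det| ≤ B ^ n := by
  obtain ⟨h1, h2⟩ := local_max_conditions hu hmax
  refine ⟨by simp [gradMap, h1], ?_⟩
  have hin := (gradMap_inner hu).2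
  have hsym : IsSymmSndFDerivAt ℝ u y := hu.isSymmSndFDerivAt (by simp)
  refine abs_det_le_of_nonpos _ ?_ ?_ B ?_
  · intro v w
    change inner ℝ (fderiv ℝ (gradMap u) y v) w = inner ℝ v (fderiv ℝ (gradMap u) y w)
    rw [real_inner_comm _ v, hin, hin]
    exact hsym v w
  · intro v
    change inner ℝ v (fderiv ℝ (gradMap u) y v) ≤ 0
    rw [real_inner_comm, hin]
    exact h2 v
  · rw [laplacian_eq hu]
    exact hB

/-- The ABP estimate. -/
lemma abp_estimate {n : ℕ} {d K M : ℝ} (hd : 0 < d) (hK : 0 ≤ K) (hM : 0 < M)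
    {Ω : Set (EuclideanSpace ℝ (Fin n))} {u c : EuclideanSpace ℝ (Fin n) → ℝ}
    (hΩ : IsOpen Ω) (hb : Bornology.IsBounded Ω) (hdiam : Metric.diam Ω ≤ d)
    (hc : ∀ x ∈ Ω, max (c x) 0 ≤ K) (hu : ContDiffOn ℝ 2 u Ω)
    (huc : ContinuousOn u (closure Ω))
    (hL : ∀ x ∈ Ω, 0 ≤ laplacian u x + c x * u x)
    (hbd : ∀ x ∈ frontier Ω, u x ≤ 0)
    {x₀ : EuclideanSpace ℝ (Fin n)} (hx₀ : x₀ ∈ closure Ω) (hux₀ : u x₀ = M)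
    (hle : ∀ x ∈ closure Ω, u x ≤ M) :
    volume (Metric.ball (0 : EuclideanSpace ℝ (Fin n)) (M / d)) ≤
      ENNReal.ofReal ((K * M) ^ n) * volume Ω := by
  set Γ : Set (EuclideanSpace ℝ (Fin n)) :=
    Ω ∩ {x | |(fderiv ℝ (gradMap u) x).det| ≤ (K * M) ^ n} with hΓ
  have hcd : ∀ x ∈ Ω, ContDiffAt ℝ 2 u x := fun x hx => hu.contDiffAt (hΩ.mem_nhds hx)
  have hmeas : MeasurableSet Γ := by
    refine hΩ.measurableSet.inter (measurableSet_le ?_ measurable_const)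
    exact (ContinuousLinearMap.continuous_det.measurable.comp
      (measurable_fderiv ℝ (gradMap u))).abs
  have hsub : Metric.ball (0 : EuclideanSpace ℝ (Fin n)) (M / d) ⊆ gradMap u '' Γ := by
    intro p hp
    have hp' : ‖p‖ * d < M := by
      rw [mem_ball_zero_iff, lt_div_iff₀ hd] at hp
      exact hp
    have hcomp : IsCompact (closure Ω) := hb.isCompact_closure
    obtain ⟨y, hy, hymax⟩ := hcomp.exists_isMaxOn ⟨x₀, hx₀⟩
      (f := fun x => u x - inner ℝ p x) (huc.sub (by fun_prop))
    have h0 : u x₀ - inner ℝ p x₀ ≤ u y - inner ℝ p y := hymax hx₀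
    have hdist : ‖y - x₀‖ ≤ d := by
      rw [← dist_eq_norm]
      refine (Metric.dist_le_diam_of_mem hb.closure hy hx₀).trans ?_
      rwa [Metric.diam_closure]
    have hin : inner ℝ p x₀ - inner ℝ p y ≤ ‖p‖ * d := by
      rw [← inner_sub_right]
      refine (real_inner_le_norm _ _).trans ?_
      rw [norm_sub_rev]
      gcongr
    have huy : 0 < u y := by linarith
    have hyΩ : y ∈ Ω := by
      by_contra hn
      have : y ∈ frontier Ω := by
        rw [hΩ.frontier_eq]; exact ⟨hy, hn⟩
      linarith [hbd y this]
    have hloc : IsLocalMax (fun x => u x - inner ℝ p x) y :=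
      hymax.isLocalMax (Filter.mem_of_superset (hΩ.mem_nhds hyΩ) subset_closure)
    have hB : - laplacian u y ≤ K * M := by
      have h1 : c y * u y ≤ K * M :=
        mul_le_mul ((le_max_left _ _).trans (hc y hyΩ)) (hle y hy) huy.le hK
      linarith [hL y hyΩ]
    obtain ⟨h1, h2⟩ := contact_bound (hcd y hyΩ) hloc _ hB
    exact ⟨y, ⟨hyΩ, h2⟩, h1⟩
  calc volume (Metric.ball (0 : EuclideanSpace ℝ (Fin n)) (M / d))
      ≤ volume (gradMap u '' Γ) := measure_mono hsub
    _ ≤ ∫⁻ x in Γ, ENNReal.ofReal |(fderiv ℝ (gradMap u) x).det| :=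
        addHaar_image_le_lintegral_abs_det_fderiv volume hmeas fun x hx =>
          (gradMap_inner (hcd x hx.1)).1.hasFDerivAt.hasFDerivWithinAt
    _ ≤ ∫⁻ _x in Γ, ENNReal.ofReal ((K * M) ^ n) :=
        setLIntegral_mono' hmeas fun x hx => ENNReal.ofReal_le_ofReal hx.2
    _ = ENNReal.ofReal ((K * M) ^ n) * volume Γ := by simp
    _ ≤ _ := by gcongr; exact Set.inter_subset_left

/-- maximum principle for domains of small volume: there is
`δ > 0` depending only on `n`, the diameter bound `d`, and the bound `K` on `c⁺`,
such that if `|Ω| ≤ δ` then every solution of `Δu + c u ≥ 0` in `Ω` with `u ≤ 0`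
on `∂Ω` satisfies `u ≤ 0` in `Ω`. -/
theorem small_volume_maximum_principle (n : ℕ) (hn : 1 ≤ n) (d K : ℝ)
    (hd : 0 < d) (hK : 0 ≤ K) :
    ∃ δ > 0, ∀ (Ω : Set (EuclideanSpace ℝ (Fin n)))
      (u c : EuclideanSpace ℝ (Fin n) → ℝ),
      IsOpen Ω → Bornology.IsBounded Ω → Metric.diam Ω ≤ d →
      (∀ x ∈ Ω, max (c x) 0 ≤ K) →
      ContDiffOn ℝ 2 u Ω → ContinuousOn u (closure Ω) →
      (∀ x ∈ Ω, 0 ≤ laplacian u x + c x * u x) →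
      (∀ x ∈ frontier Ω, u x ≤ 0) →
      volume Ω ≤ ENNReal.ofReal δ →
      ∀ x ∈ Ω, u x ≤ 0 := by
  set ω : ℝ := (volume (Metric.ball (0 : EuclideanSpace ℝ (Fin n)) 1)).toReal with hω
  have hω0 : 0 < ω := ENNReal.toReal_pos (Metric.measure_ball_pos _ _ one_pos).ne'
    measure_ball_lt_top.ne
  have hω1 : volume (Metric.ball (0 : EuclideanSpace ℝ (Fin n)) 1) = ENNReal.ofReal ω :=
    (ENNReal.ofReal_toReal measure_ball_lt_top.ne).symm
  have hKd : 0 ≤ (K * d) ^ n := by positivity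
  refine ⟨ω / ((K * d) ^ n + 1), by positivity, ?_⟩
  intro Ω u c hΩ hb hdiam hc hu huc hL hbd hvol x hx
  by_contra! hpos
  obtain ⟨x₀, hx₀, hmax⟩ := hb.isCompact_closure.exists_isMaxOn ⟨x, subset_closure hx⟩ huc
  have hM : 0 < u x₀ := hpos.trans_le (hmax (subset_closure hx))
  have habp := abp_estimate hd hK hM hΩ hb hdiam hc hu huc hL hbd hx₀ rfl fun y hy => hmax hy
  set M := u x₀
  rw [Measure.addHaar_ball_of_pos _ _ (by positivity), hω1, finrank_euclideanSpace_fin] at habp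
  have h2 := habp.trans (mul_le_mul_right hvol _)
  rw [← ENNReal.ofReal_mul (by positivity), ← ENNReal.ofReal_mul (by positivity),
    ENNReal.ofReal_le_ofReal_iff (by positivity)] at h2
  have h3 : (K * M) ^ n = (K * d) ^ n * (M / d) ^ n := by
    rw [← mul_pow]; congr 1; field_simp
  have hMd : 0 < (M / d) ^ n := by positivity
  rw [h3] at h2
  have h4 : ω ≤ (K * d) ^ n * (ω / ((K * d) ^ n + 1)) := by
    refine le_of_mul_le_mul_left ?_ hMd
    linarith
  rw [← mul_div_assoc, le_div_iff₀ (by positivity)] at h4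
  linarith
end
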